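/- (Exact fermionic high-temperature expansion.) Let α ∈ ℂ with α ∉ ℤ, N ∈ ℕ, ω_c > 0, 0 < μ < ω_c, β > 0, c_0, …, c_N ∈ ℂ, and let g : [ω_c, ∞) → ℂ be measurable, locally integrable, with g(ω) − Σ_{k=0}^{N} c_k ω^{α−k} = O(ω^{Re α − N − 1}) as ω → +∞. Let θ be a real number with θ ∉ ℤ, θ > −1, N − Re α − 1 < θ < N − Re α. Then, with η(z) := (1 − 2^{1−z})ζ(z), and with a_m(μ) and the continued function Σ_g(s, μ) as below, ∫_{ω_c}^{∞} g(ω)/(e^{β(ω−μ)} + 1) dω = Σ_{m=0}^{N} β^{m−α−1} η(α+1−m) Σ_{n=0}^{m} Γ(α+1−m+n) c_{m−n} μ^n/n! + Σ_{l=0}^{⌊θ⌋} ((−1)^l η(−l)/l!) · β^l · Σ_g(l, μ) + (1/(2π)) ∫_{−∞}^{∞} Γ(−θ−it) · η(−θ−it) · β^{θ+it} · Σ_g(θ+it, μ) dt, all integrals and sums converging absolutely; in particular there is no l = −1 term, since η is regular at 1. -/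

import Mathlib

open MeasureTheory Complex Filter


/-- Fermi function. -/
noncomputable def fdR (y : ℝ) : ℝ := 1 / (Real.exp y + 1)

/-- complex-valued -/
noncomputable def fdC (y : ℝ) : ℂ := (fdR y : ℂ)

/-- eta -/
noncomputable def etaC (z : ℂ) : ℂ := (1 - (2 : ℂ) ^ (1 - z)) * riemannZeta z

lemma fdR_pos (y : ℝ) : 0 < fdR y := by unfold fdR; positivity

lemma fdR_le_one (y : ℝ) : fdR y ≤ 1 := by
  unfold fdR
  rw [div_le_one (by positivity)]
  linarith [Real.exp_pos y]

lemma fdR_le_exp (y : ℝ) : fdR y ≤ Real.exp (-y) := by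
  unfold fdR
  rw [Real.exp_neg, ← one_div]
  exact one_div_le_one_div_of_le (Real.exp_pos y) (by linarith)

lemma hasDerivAt_fdR (y : ℝ) : HasDerivAt fdR (fdR y ^ 2 - fdR y) y := by
  have h1 : HasDerivAt (fun y => Real.exp y + 1) (Real.exp y) y := (Real.hasDerivAt_exp y).add_const 1
  have h0 : Real.exp y + 1 ≠ 0 := by positivity
  have := h1.inv h0
  have h2 : fdR = (fun y => Real.exp y + 1)⁻¹ := by
    ext y; simp [fdR]
  rw [h2]
  convert! this using 1
  change ((Real.exp y + 1)⁻¹) ^ 2 - (Real.exp y + 1)⁻¹ = _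
  field_simp
  ring

lemma continuous_fdR : Continuous fdR :=
  continuous_iff_continuousAt.2 fun y => (hasDerivAt_fdR y).continuousAt

lemma altSum {b : ℕ → ℂ} (hb : Summable b) (q : ℂ) (hq : ∀ k, b (2 * k + 1) = q * b k) :
    HasSum (fun n : ℕ => (-1 : ℂ) ^ n * b n) ((1 - 2 * q) * ∑' n, b n) := by
  have hinj0 : Function.Injective (fun k : ℕ => 2 * k) := by
    intro a b h
    have h : 2 * a = 2 * b := h
    omega
  have he : HasSum (fun k => b (2 * k)) (∑' k, b (2 * k)) := (hb.comp_injective hinj0).hasSum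
  have ho : HasSum (fun k => b (2 * k + 1)) (q * ∑' n, b n) := by
    simp only [hq]
    exact hb.hasSum.mul_left q
  have tot := (HasSum.even_add_odd he ho).unique hb.hasSum
  have e1 : HasSum (fun k => (fun n : ℕ => (-1 : ℂ) ^ n * b n) (2 * k)) (∑' k, b (2 * k)) := by
    simp only [pow_mul, neg_one_sq, one_pow, one_mul]
    exact he
  have o1 : HasSum (fun k => (fun n : ℕ => (-1 : ℂ) ^ n * b n) (2 * k + 1)) (-(q * ∑' n, b n)) := by
    simp only [pow_add, pow_mul, neg_one_sq, one_pow, one_mul, pow_one, neg_mul]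
    exact ho.neg
  have res := HasSum.even_add_odd (f := fun n : ℕ => (-1 : ℂ) ^ n * b n) e1 o1
  have e : (1 - 2 * q) * ∑' n, b n = ∑' k, b (2 * k) + -(q * ∑' n, b n) := by
    generalize (∑' n, b n) = A at tot ⊢
    generalize (∑' k, b (2 * k)) = B at tot ⊢
    linear_combination -tot
  rw [e]
  exact res

lemma etaSum {s : ℂ} (hs : 1 < s.re) :
    HasSum (fun n : ℕ => (-1 : ℂ) ^ n * (1 / ((n : ℂ) + 1) ^ s)) (etaC s) := by
  have hsum : Summable (fun n : ℕ => 1 / ((n : ℂ) + 1) ^ s) := by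
    have := (summable_nat_add_iff 1).2 (Complex.summable_one_div_nat_cpow.2 hs)
    simpa using this
  have hz := zeta_eq_tsum_one_div_nat_add_one_cpow hs
  have hodd : ∀ k : ℕ, 1 / (((2 * k + 1 : ℕ) : ℂ) + 1) ^ s = (2 : ℂ) ^ (-s) * (1 / ((k : ℂ) + 1) ^ s) := by
    intro k
    have h1 : (((2 * k + 1 : ℕ) : ℂ) + 1) = ((2 : ℝ) : ℂ) * (((k + 1 : ℝ)) : ℂ) := by
      push_cast; ring
    rw [h1, Complex.mul_cpow_ofReal_nonneg (by norm_num) (by positivity), Complex.cpow_neg]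
    push_cast
    rw [one_div, mul_inv, one_div]
  have := altSum hsum _ hodd
  rw [etaC, hz, sub_eq_add_neg 1 s, Complex.cpow_add _ _ two_ne_zero, Complex.cpow_one]
  exact this

lemma mellin_fdC {s : ℂ} (hs : 1 < s.re) : mellin fdC s = Complex.Gamma s * etaC s := by
  have h := hasSum_mellin (a := fun n : ℕ => (-1 : ℂ) ^ n) (p := fun n : ℕ => (n : ℝ) + 1) (F := fdC)
    (s := s) (fun i => Or.inr (by positivity)) (by linarith) ?_ ?_
  · refine h.unique ?_
    convert! (etaSum hs).mul_left (Complex.Gamma s) using 2 with n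
    push_cast
    ring
  · intro t ht
    have ht : 0 < t := ht
    have hq : ‖(-(Real.exp (-t) : ℂ))‖ < 1 := by
      rw [norm_neg, Complex.norm_real, Real.norm_eq_abs, Real.abs_exp]
      exact Real.exp_lt_one_iff.2 (by linarith)
    have := (hasSum_geometric_of_norm_lt_one hq).mul_left (Real.exp (-t) : ℂ)
    convert! this using 2 with n
    · rw [neg_pow (Real.exp (-t) : ℂ), ← Complex.ofReal_pow, ← Real.exp_nat_mul]
      rw [mul_left_comm, ← Complex.ofReal_mul, ← Real.exp_add]
      congr 3
      ring
    · rw [fdC, fdR, Real.exp_neg]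
      have : Real.exp t + 1 ≠ 0 := by positivity
      have h2 : Real.exp t ≠ 0 := by positivity
      have h3 : (1 + ((Real.exp t)⁻¹ : ℝ) : ℝ) ≠ 0 := by positivity
      rw [sub_neg_eq_add]
      norm_cast
      field_simp
  · have := (summable_nat_add_iff 1).2 (Real.summable_one_div_nat_rpow.2 hs)
    simpa using this

/-- identity principle -/
lemma ident_principle {L : ℝ} {F H : ℂ → ℂ}
    (hF : ∀ z : ℂ, -L < z.re → (∀ n : ℤ, z ≠ n) → DifferentiableAt ℂ F z)
    (hH : ∀ z : ℂ, -L < z.re → (∀ n : ℤ, z ≠ n) → DifferentiableAt ℂ H z)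
    (heq : ∀ z : ℂ, 1 < z.re → F z = H z)
    (z : ℂ) (hz : -L < z.re) (hzZ : ∀ n : ℤ, z ≠ n) : F z = H z := by
  have nonint : ∀ w : ℂ, w.im ≠ 0 → ∀ n : ℤ, w ≠ n := by
    rintro w hw n rfl
    simp at hw
  have key : ∀ U : Set ℂ, Convex ℝ U → IsOpen U → (∀ w ∈ U, -L < w.re ∧ w.im ≠ 0) →
      (∃ w ∈ U, 1 < w.re) → ∀ w ∈ U, F w = H w := by
    intro U hc ho hU ⟨w0, hw0, hw1⟩ w hw
    have hFa : AnalyticOnNhd ℂ F U := by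
      apply DifferentiableOn.analyticOnNhd _ ho
      intro x hx
      exact (hF x (hU x hx).1 (nonint x (hU x hx).2)).differentiableWithinAt
    have hHa : AnalyticOnNhd ℂ H U := by
      apply DifferentiableOn.analyticOnNhd _ ho
      intro x hx
      exact (hH x (hU x hx).1 (nonint x (hU x hx).2)).differentiableWithinAt
    refine hFa.eqOn_of_preconnected_of_eventuallyEq hHa hc.isPreconnected hw0 ?_ hw
    filter_upwards [(isOpen_lt continuous_const Complex.continuous_re).mem_nhds hw1] with x hx
    exact heq x hx
  have up : ∀ w : ℂ, -L < w.re → 0 < w.im → F w = H w := by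
    intro w h1 h2
    refine key {w | -L < w.re ∧ 0 < w.im} ?_ ?_ ?_ ?_ w ⟨h1, h2⟩
    · exact (convex_halfSpace_re_gt _).inter (convex_halfSpace_im_gt _)
    · exact (isOpen_lt continuous_const Complex.continuous_re).inter
        (isOpen_lt continuous_const Complex.continuous_im)
    · exact fun w hw => ⟨hw.1, hw.2.ne'⟩
    · refine ⟨⟨|L| + 2, 1⟩, ⟨?_, ?_⟩, ?_⟩
      · change -L < |L| + 2
        linarith [neg_abs_le L]
      · change (0:ℝ) < 1
        norm_num
      · change 1 < |L| + 2
        linarith [abs_nonneg L]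
  have dn : ∀ w : ℂ, -L < w.re → w.im < 0 → F w = H w := by
    intro w h1 h2
    refine key {w | -L < w.re ∧ w.im < 0} ?_ ?_ ?_ ?_ w ⟨h1, h2⟩
    · exact (convex_halfSpace_re_gt _).inter (convex_halfSpace_im_lt _)
    · exact (isOpen_lt continuous_const Complex.continuous_re).inter
        (isOpen_lt Complex.continuous_im continuous_const)
    · exact fun w hw => ⟨hw.1, hw.2.ne⟩
    · refine ⟨⟨|L| + 2, -1⟩, ⟨?_, ?_⟩, ?_⟩
      · change -L < |L| + 2
        linarith [neg_abs_le L]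
      · change (-1:ℝ) < 0
        norm_num
      · change 1 < |L| + 2
        linarith [abs_nonneg L]
  rcases lt_trichotomy z.im 0 with h | h | h
  · exact dn z hz h
  · have hl : Tendsto (fun t : ℝ => z + t * I) (nhdsWithin 0 (Set.Ioi 0)) (nhds z) := by
      have : Continuous (fun t : ℝ => z + t * I) := by fun_prop
      have := this.tendsto 0
      simp only [ofReal_zero, zero_mul, add_zero] at this
      exact this.mono_left nhdsWithin_le_nhds
    have t1 := (hF z hz hzZ).continuousAt.tendsto.comp hl
    have t2 := (hH z hz hzZ).continuousAt.tendsto.comp hl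
    refine tendsto_nhds_unique_of_eventuallyEq t1 t2 ?_
    filter_upwards [self_mem_nhdsWithin] with t ht
    apply up
    · simpa using hz
    · simpa [h] using ht
  · exact up z hz h

lemma differentiableAt_Gamma_etaC {z : ℂ} (hz : ∀ n : ℤ, z ≠ n) :
    DifferentiableAt ℂ (fun s => Complex.Gamma s * etaC s) z := by
  apply DifferentiableAt.mul
  · exact Complex.differentiableAt_Gamma z (fun m => by simpa using hz (-(m : ℤ)))
  · unfold etaC
    apply DifferentiableAt.mul
    · apply DifferentiableAt.sub (differentiableAt_const _)
      apply DifferentiableAt.const_cpow (by fun_prop) (Or.inl two_ne_zero)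
    · exact differentiableAt_riemannZeta (by simpa using hz 1)


/-- polynomial in the Fermi function, with a factor of the Fermi function -/
noncomputable def fdP (p : Polynomial ℝ) (y : ℝ) : ℂ := ((fdR y * p.eval (fdR y) : ℝ) : ℂ)

/-- the derivation -/
noncomputable def dP (p : Polynomial ℝ) : Polynomial ℝ :=
  (p + Polynomial.X * p.derivative) * (Polynomial.X - 1)

lemma hasDerivAt_fdP (p : Polynomial ℝ) (y : ℝ) : HasDerivAt (fdP p) (fdP (dP p) y) y := by
  have h1 := hasDerivAt_fdR y
  have h2 := (p.hasDerivAt (fdR y)).comp y h1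
  have h3 := (h1.mul h2).ofReal_comp
  convert! h3 using 1
  simp only [fdP, dP, Polynomial.eval_mul, Polynomial.eval_add, Polynomial.eval_sub,
    Polynomial.eval_X, Polynomial.eval_one, Function.comp]
  congr 1
  ring

lemma continuous_fdP (p : Polynomial ℝ) : Continuous (fdP p) :=
  continuous_iff_continuousAt.2 fun y => (hasDerivAt_fdP p y).continuousAt

lemma fdP_bound (p : Polynomial ℝ) : ∃ C : ℝ, 0 ≤ C ∧ ∀ y, ‖fdP p y‖ ≤ C * fdR y := by
  obtain ⟨C, hC⟩ := (isCompact_Icc (a := (0:ℝ)) (b := 1)).exists_bound_of_continuousOn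
    (f := fun x => p.eval x) p.continuous.continuousOn
  refine ⟨C, (norm_nonneg _).trans (hC 0 (by simp)), fun y => ?_⟩
  rw [fdP, Complex.norm_real, norm_mul, mul_comm, Real.norm_of_nonneg (fdR_pos y).le]
  exact mul_le_mul_of_nonneg_right (hC _ ⟨(fdR_pos y).le, fdR_le_one y⟩) (fdR_pos y).le

lemma fdP_top (p : Polynomial ℝ) : (fdP p) =O[atTop] fun t => Real.exp (-1 * t) := by
  obtain ⟨C, hC0, hC⟩ := fdP_bound p
  refine Asymptotics.IsBigO.of_bound C (Eventually.of_forall fun y => ?_)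
  rw [Real.norm_of_nonneg (Real.exp_pos _).le]
  refine (hC y).trans (mul_le_mul_of_nonneg_left ?_ hC0)
  simpa using fdR_le_exp y

lemma fdP_bot (p : Polynomial ℝ) : (fdP p) =O[nhdsWithin 0 (Set.Ioi 0)] fun t : ℝ => t ^ (-(0:ℝ)) := by
  obtain ⟨C, hC0, hC⟩ := fdP_bound p
  refine Asymptotics.IsBigO.of_bound C (Eventually.of_forall fun y => ?_)
  simp only [neg_zero, Real.rpow_zero, norm_one]
  exact (hC y).trans (mul_le_mul_of_nonneg_left (fdR_le_one y) hC0)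

lemma fdP_conv (p : Polynomial ℝ) {s : ℂ} (hs : 0 < s.re) : MellinConvergent (fdP p) s :=
  mellinConvergent_of_isBigO_rpow_exp one_pos
    ((continuous_fdP p).locallyIntegrable.locallyIntegrableOn _) (fdP_top p) (fdP_bot p) hs

lemma fdP_diff (p : Polynomial ℝ) {s : ℂ} (hs : 0 < s.re) : DifferentiableAt ℂ (mellin (fdP p)) s :=
  mellin_differentiableAt_of_isBigO_rpow_exp one_pos
    ((continuous_fdP p).locallyIntegrable.locallyIntegrableOn _) (fdP_top p) (fdP_bot p) hs

lemma fdP_parts (p : Polynomial ℝ) {s : ℂ} (hs : 0 < s.re) :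
    s * mellin (fdP p) s = - mellin (fdP (dP p)) (s + 1) := by
  have hs0 : s ≠ 0 := by rintro rfl; simp at hs
  have hc1 := fdP_conv p hs
  have hc2 := fdP_conv (dP p) (s := s + 1) (by simp; linarith)
  obtain ⟨C, hC0, hC⟩ := fdP_bound p
  have hn : ∀ x : ℝ, 0 < x → ‖(x : ℂ) ^ s * fdP p x‖ ≤ C * (x ^ s.re * fdR x) := by
    intro x hx
    rw [norm_mul, Complex.norm_cpow_eq_rpow_re_of_pos hx]
    calc _ ≤ x ^ s.re * (C * fdR x) := by gcongr; exact hC x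
      _ = _ := by ring
  have h0 : Tendsto ((fun x : ℝ => (x : ℂ) ^ s) * fdP p) (nhdsWithin 0 (Set.Ioi 0)) (nhds 0) := by
    apply squeeze_zero_norm' (a := fun x : ℝ => C * (x ^ s.re))
    · filter_upwards [self_mem_nhdsWithin] with x hx
      refine (hn x hx).trans ?_
      gcongr
      have : 0 ≤ x ^ s.re := Real.rpow_nonneg (le_of_lt hx) _
      nlinarith [fdR_le_one x]
    · have : ContinuousAt (fun x : ℝ => C * x ^ s.re) 0 :=
        continuousAt_const.mul (Real.continuousAt_rpow_const _ _ (Or.inr hs.le))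
      have := this.tendsto
      simp only [Real.zero_rpow hs.ne', mul_zero] at this
      exact this.mono_left nhdsWithin_le_nhds
  have h1 : Tendsto ((fun x : ℝ => (x : ℂ) ^ s) * fdP p) atTop (nhds 0) := by
    apply squeeze_zero_norm' (a := fun x : ℝ => C * (x ^ s.re * Real.exp (-1 * x)))
    · filter_upwards [eventually_gt_atTop 0] with x hx
      refine (hn x hx).trans ?_
      have := fdR_le_exp x
      gcongr
      simpa using this
    · simpa using (tendsto_rpow_mul_exp_neg_mul_atTop_nhds_zero s.re 1 one_pos).const_mul C
  have := integral_Ioi_mul_deriv_eq_deriv_mul (a := (0:ℝ)) (u := fun x : ℝ => (x : ℂ) ^ s)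
    (u' := fun x : ℝ => s * (x : ℂ) ^ (s - 1)) (v := fdP p) (v' := fdP (dP p)) (a' := 0) (b' := 0)
    (fun x hx => ?_) (fun x _ => hasDerivAt_fdP p x) ?_ ?_ h0 h1
  · simp only [mellin, smul_eq_mul, add_sub_cancel_right]
    rw [this, ← integral_const_mul]
    simp [mul_assoc]
  · exact hasDerivAt_ofReal_cpow_const (ne_of_gt hx) hs0
  · have := hc2
    simp only [MellinConvergent, add_sub_cancel_right, smul_eq_mul] at this
    exact this
  · have := hc1.const_mul s
    simp only [smul_eq_mul, ← mul_assoc] at this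
    exact this

lemma fdP_parts_iter (K : ℕ) : ∀ (p : Polynomial ℝ) {s : ℂ} (_ : 0 < s.re),
    (∏ j ∈ Finset.range K, (s + j)) * mellin (fdP p) s
      = (-1) ^ K * mellin (fdP (dP^[K] p)) (s + K) := by
  induction K with
  | zero => intro p s hs; simp
  | succ K ih =>
    intro p s hs
    rw [Finset.prod_range_succ', Function.iterate_succ_apply]
    have h1 := ih (dP p) (s := s + 1) (by simp; linarith)
    have h2 := fdP_parts p hs
    have e : ∀ j : ℕ, s + ((j + 1 : ℕ) : ℂ) = s + 1 + j := by intro j; push_cast; ring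
    simp only [e]
    push_cast
    rw [add_zero, mul_assoc, h2, pow_succ]
    linear_combination -h1

lemma fdC_eq : fdC = fdP 1 := by
  ext y; simp [fdC, fdP]

lemma GE_prod (K : ℕ) {s : ℂ} (hs : -(K : ℝ) < s.re) (hsZ : ∀ n : ℤ, s ≠ n) :
    (∏ j ∈ Finset.range K, (s + j)) * (Complex.Gamma s * etaC s)
      = (-1) ^ K * mellin (fdP (dP^[K] 1)) (s + K) := by
  refine ident_principle (L := K) (F := fun s => (∏ j ∈ Finset.range K, (s + j)) * (Complex.Gamma s * etaC s))
    (H := fun s => (-1) ^ K * mellin (fdP (dP^[K] 1)) (s + K)) ?_ ?_ ?_ s hs hsZ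
  · intro z _ hz
    exact DifferentiableAt.mul (by fun_prop) (differentiableAt_Gamma_etaC hz)
  · intro z hz _
    apply DifferentiableAt.const_mul
    have := fdP_diff (dP^[K] 1) (s := z + K) (by simp; linarith)
    exact DifferentiableAt.comp (g := mellin (fdP (dP^[K] 1))) (f := fun z : ℂ => z + K) z this (by fun_prop)
  · intro z hz
    change _ = _
    rw [← fdP_parts_iter K 1 (by linarith), ← mellin_fdC hz, fdC_eq]

lemma vert_integrable (θ : ℝ) (hθ : ∀ n : ℤ, θ ≠ n) :
    Integrable (fun t : ℝ => Complex.Gamma (-(θ : ℂ) - t * I) * etaC (-(θ : ℂ) - t * I)) := by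
  have hZ : ∀ t : ℝ, ∀ n : ℤ, (-(θ : ℂ) - t * I) ≠ n := by
    intro t n h
    have := congrArg Complex.re h
    simp at this
    apply hθ (-n)
    push_cast
    linarith
  obtain ⟨K, hK2, hK⟩ : ∃ K : ℕ, 2 ≤ K ∧ θ < K := by
    obtain ⟨K, hK⟩ := exists_nat_gt θ
    exact ⟨K + 2, by omega, by push_cast; linarith⟩
  have hcont : Continuous (fun t : ℝ => Complex.Gamma (-(θ : ℂ) - t * I) * etaC (-(θ : ℂ) - t * I)) := by
    rw [continuous_iff_continuousAt]
    intro t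
    exact ContinuousAt.comp (f := fun t : ℝ => (-(θ : ℂ) - t * I))
      (differentiableAt_Gamma_etaC (hZ t)).continuousAt (by fun_prop)
  set A : ℝ := ∫ y in Set.Ioi (0:ℝ), y ^ (K - θ - 1) * ‖fdP (dP^[K] 1) y‖ with hA
  have hA0 : 0 ≤ A := setIntegral_nonneg measurableSet_Ioi fun y hy =>
    mul_nonneg (Real.rpow_nonneg (le_of_lt hy) _) (norm_nonneg _)
  have bound : ∀ t : ℝ, 1 ≤ |t| →
      ‖Complex.Gamma (-(θ : ℂ) - t * I) * etaC (-(θ : ℂ) - t * I)‖ ≤ 2 * A * ‖(1 + t ^ 2)⁻¹‖ := by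
    intro t ht
    set s : ℂ := -(θ : ℂ) - t * I with hs
    have hre : s.re = -θ := by simp [hs]
    have him : s.im = -t := by simp [hs]
    have h := GE_prod K (s := s) (by rw [hre]; linarith) (hZ t)
    have hm : ‖mellin (fdP (dP^[K] 1)) (s + K)‖ ≤ A := by
      refine (norm_integral_le_integral_norm _).trans (le_of_eq ?_)
      refine setIntegral_congr_fun measurableSet_Ioi fun y hy => ?_
      simp only [norm_smul]
      rw [Complex.norm_cpow_eq_rpow_re_of_pos hy]
      simp [hre]
      left
      congr 1
      ring
    have hp : t ^ 2 ≤ ‖∏ j ∈ Finset.range K, (s + j)‖ := by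
      rw [norm_prod]
      calc t ^ 2 = |t| ^ 2 := (sq_abs t).symm
        _ ≤ |t| ^ K := pow_le_pow_right₀ ht hK2
        _ = ∏ j ∈ Finset.range K, |t| := by simp
        _ ≤ _ := by
          apply Finset.prod_le_prod
          · intros; positivity
          · intro j _
            have := Complex.abs_im_le_norm (s + j)
            simpa [him] using this
    have h2 := congrArg norm h
    rw [norm_mul, norm_mul ((-1 : ℂ) ^ K), norm_pow, norm_neg, norm_one, one_pow, one_mul] at h2
    have ht2 : 1 ≤ t ^ 2 := by rw [← sq_abs]; nlinarith
    have h3 : t ^ 2 * ‖Complex.Gamma s * etaC s‖ ≤ A := by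
      refine le_trans ?_ (h2.le.trans hm)
      gcongr
    rw [Real.norm_of_nonneg (by positivity), ← div_eq_mul_inv, le_div_iff₀ (by positivity)]
    nlinarith [norm_nonneg (Complex.Gamma s * etaC s)]
  have hO : ∀ l : Filter ℝ, (∀ᶠ t in l, 1 ≤ |t|) →
      (fun t : ℝ => Complex.Gamma (-(θ : ℂ) - t * I) * etaC (-(θ : ℂ) - t * I)) =O[l]
        fun t : ℝ => (1 + t ^ 2)⁻¹ := by
    intro l hl
    exact Asymptotics.IsBigO.of_bound (2 * A) (hl.mono bound)
  refine hcont.locallyIntegrable.integrable_of_isBigO_atBot_atTop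
    (hO _ ?_) (integrable_inv_one_add_sq.integrableAtFilter _)
    (hO _ ?_) (integrable_inv_one_add_sq.integrableAtFilter _)
  · exact (tendsto_abs_atBot_atTop).eventually_ge_atTop 1
  · exact (tendsto_abs_atTop_atTop).eventually_ge_atTop 1


/-- `b` is the sequence of Taylor coefficients of the Fermi function at zero. -/
def FdTay (b : ℕ → ℂ) : Prop := ∀ L : ℕ,
    (fun y : ℝ => fdC y - ∑ l ∈ Finset.range L, b l * (y : ℂ) ^ l)
      =O[nhdsWithin 0 (Set.Ioi 0)] fun y : ℝ => y ^ (-(-(L : ℝ)))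

lemma fd_taylor : ∃ b : ℕ → ℂ, FdTay b := by
  have han : AnalyticAt ℝ fdR 0 := by
    unfold fdR
    refine AnalyticAt.div analyticAt_const (analyticAt_rexp.add analyticAt_const) (by positivity)
  obtain ⟨p, hp⟩ := han
  refine ⟨fun l => (p.coeff l : ℂ), fun L => ?_⟩
  have h := (hp.isBigO_sub_partialSum_pow L).mono (nhdsWithin_le_nhds (s := Set.Ioi 0))
  have h2 : (fun y : ℝ => ((fdR (0 + y) - p.partialSum L y : ℝ) : ℂ))
      =O[nhdsWithin 0 (Set.Ioi 0)] fun y : ℝ => ‖y‖ ^ L := by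
    refine Asymptotics.IsBigO.trans (Asymptotics.IsBigO.of_bound 1 (Eventually.of_forall fun y => ?_)) h
    rw [Complex.norm_real, one_mul]
  refine (h2.congr' ?_ ?_)
  · refine Eventually.of_forall fun y => ?_
    simp only [zero_add, FormalMultilinearSeries.partialSum, fdC]
    push_cast
    congr 1
    refine Finset.sum_congr rfl fun l _ => ?_
    rw [FormalMultilinearSeries.apply_eq_pow_smul_coeff]
    push_cast [smul_eq_mul]
    ring
  · filter_upwards [self_mem_nhdsWithin] with y hy
    rw [neg_neg, Real.rpow_natCast, Real.norm_of_nonneg (le_of_lt hy)]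

/-- cut-off remainder -/
noncomputable def fdE (b : ℕ → ℂ) (L : ℕ) (d : ℝ) (y : ℝ) : ℂ :=
  fdC y - (Set.Ioc 0 d).indicator (fun y : ℝ => ∑ l ∈ Finset.range L, b l * (y : ℂ) ^ l) y

lemma cpow_Ioc {w : ℂ} (hw : 0 < w.re) {d : ℝ} (hd : 0 < d) :
    IntegrableOn (fun y : ℝ => (y : ℂ) ^ (w - 1)) (Set.Ioc 0 d) ∧
    ∫ y in Set.Ioc 0 d, (y : ℂ) ^ (w - 1) = (d : ℂ) ^ w / w := by
  have h1 : -1 < (w - 1).re := by simp; linarith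
  have hw0 : w ≠ 0 := by rintro rfl; simp at hw
  constructor
  · have := intervalIntegral.intervalIntegrable_cpow' (a := 0) (b := d) h1
    exact (intervalIntegrable_iff_integrableOn_Ioc_of_le hd.le).1 this
  · rw [← intervalIntegral.integral_of_le hd.le, integral_cpow (Or.inl h1)]
    simp [hw0]

lemma cpow_mul_pow {y : ℝ} (hy : 0 < y) (s : ℂ) (l : ℕ) :
    (y : ℂ) ^ (s - 1) * (y : ℂ) ^ l = (y : ℂ) ^ ((s + l) - 1) := by
  rw [← Complex.cpow_natCast, ← Complex.cpow_add _ _ (by exact_mod_cast hy.ne')]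
  congr 1
  ring

lemma hasMellin_polyIoc (b : ℕ → ℂ) (L : ℕ) {d : ℝ} (hd : 0 < d) {s : ℂ} (hs : 0 < s.re) :
    HasMellin ((Set.Ioc 0 d).indicator (fun y : ℝ => ∑ l ∈ Finset.range L, b l * (y : ℂ) ^ l)) s
      (∑ l ∈ Finset.range L, b l * ((d : ℂ) ^ (l + s) / (l + s))) := by
  have e : ∀ y : ℝ, (y : ℂ) ^ (s - 1) • (Set.Ioc 0 d).indicator
      (fun y : ℝ => ∑ l ∈ Finset.range L, b l * (y : ℂ) ^ l) y = (Set.Ioc 0 d).indicator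
      (fun y : ℝ => ∑ l ∈ Finset.range L, b l * (y : ℂ) ^ ((s + l) - 1)) y := by
    intro y
    by_cases hy : y ∈ Set.Ioc 0 d
    · rw [Set.indicator_of_mem hy, Set.indicator_of_mem hy, smul_eq_mul, Finset.mul_sum]
      refine Finset.sum_congr rfl fun l _ => ?_
      rw [← cpow_mul_pow hy.1]
      ring
    · simp [Set.indicator_of_notMem hy]
  have hre : ∀ l : ℕ, 0 < (s + l).re := by
    intro l
    have : (0:ℝ) ≤ l := by positivity
    simp; linarith
  have hi : ∀ l ∈ Finset.range L, IntegrableOn (fun y : ℝ => b l * (y : ℂ) ^ ((s + l) - 1)) (Set.Ioc 0 d) :=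
    fun l _ => (cpow_Ioc (hre l) hd).1.const_mul _
  have hsub : Set.Ioi (0:ℝ) ∩ Set.Ioc 0 d = Set.Ioc 0 d :=
    Set.inter_eq_right.2 fun x hx => hx.1
  constructor
  · rw [MellinConvergent]
    simp only [e]
    rw [integrableOn_indicator_iff measurableSet_Ioc, Set.inter_comm, hsub]
    exact integrable_finsetSum _ hi
  · rw [mellin]
    simp only [e]
    rw [setIntegral_indicator measurableSet_Ioc, hsub, integral_finsetSum _ hi]
    refine Finset.sum_congr rfl fun l _ => ?_
    rw [integral_const_mul, (cpow_Ioc (hre l) hd).2, add_comm s]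

lemma continuous_fdC : Continuous fdC := by
  rw [fdC_eq]; exact continuous_fdP 1

lemma fdE_loc {b : ℕ → ℂ} (L : ℕ) (d : ℝ) : LocallyIntegrableOn (fdE b L d) (Set.Ioi 0) := by
  have h1 : LocallyIntegrable (fun y : ℝ => ∑ l ∈ Finset.range L, b l * (y : ℂ) ^ l) :=
    Continuous.locallyIntegrable (by fun_prop)
  have h2 : LocallyIntegrable (fdE b L d) :=
    continuous_fdC.locallyIntegrable.sub (h1.indicator measurableSet_Ioc)
  exact h2.locallyIntegrableOn _

lemma fdE_top {b : ℕ → ℂ} (L : ℕ) (d : ℝ) : (fdE b L d) =O[atTop] fun t => Real.exp (-1 * t) := by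
  have := fdP_top 1
  rw [← fdC_eq] at this
  refine this.congr' ?_ EventuallyEq.rfl
  filter_upwards [eventually_gt_atTop d] with y hy
  rw [fdE, Set.indicator_of_notMem (fun h => not_lt.2 h.2 hy), sub_zero]

lemma fdE_bot {b : ℕ → ℂ} (hb : FdTay b) (L : ℕ) {d : ℝ} (hd : 0 < d) :
    (fdE b L d) =O[nhdsWithin 0 (Set.Ioi 0)] fun y : ℝ => y ^ (-(-(L : ℝ))) := by
  refine (hb L).congr' ?_ EventuallyEq.rfl
  filter_upwards [Ioc_mem_nhdsGT hd] with y hy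
  rw [fdE, Set.indicator_of_mem hy]

lemma fdE_conv {b : ℕ → ℂ} (hb : FdTay b) (L : ℕ) {d : ℝ} (hd : 0 < d) {s : ℂ} (hs : -(L:ℝ) < s.re) : MellinConvergent (fdE b L d) s :=
  mellinConvergent_of_isBigO_rpow_exp one_pos (fdE_loc L d) (fdE_top L d) (fdE_bot hb L hd) hs

lemma fdE_diff {b : ℕ → ℂ} (hb : FdTay b) (L : ℕ) {d : ℝ} (hd : 0 < d) {s : ℂ} (hs : -(L:ℝ) < s.re) :
    DifferentiableAt ℂ (mellin (fdE b L d)) s :=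
  mellin_differentiableAt_of_isBigO_rpow_exp one_pos (fdE_loc L d) (fdE_top L d) (fdE_bot hb L hd) hs

lemma fdE_mellin {b : ℕ → ℂ} (hb : FdTay b) (L : ℕ) {d : ℝ} (hd : 0 < d) {s : ℂ} (hs : -(L:ℝ) < s.re) (hsZ : ∀ n : ℤ, s ≠ n) :
    mellin (fdE b L d) s + ∑ l ∈ Finset.range L, b l * ((d : ℂ) ^ (l + s) / (l + s))
      = Complex.Gamma s * etaC s := by
  refine ident_principle (L := L)
    (F := fun s => mellin (fdE b L d) s + ∑ l ∈ Finset.range L, b l * ((d : ℂ) ^ (l + s) / (l + s)))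
    (H := fun s => Complex.Gamma s * etaC s) ?_ ?_ ?_ s hs hsZ
  · intro z hz hzZ
    refine (fdE_diff hb L hd hz).add ?_
    refine DifferentiableAt.fun_sum fun l _ => ?_
    refine DifferentiableAt.const_mul (DifferentiableAt.div ?_ (by fun_prop) ?_) _
    · exact DifferentiableAt.const_cpow (by fun_prop) (Or.inl (by exact_mod_cast hd.ne'))
    · intro h
      apply hzZ (-(l:ℤ))
      push_cast
      linear_combination h
  · intro z _ hz
    exact differentiableAt_Gamma_etaC hz
  · intro z hz
    have h1 := hasMellin_polyIoc b L hd (s := z) (by linarith)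
    have h2 : MellinConvergent fdC z := by rw [fdC_eq]; exact fdP_conv 1 (by linarith)
    have h3 := (hasMellin_sub h2 h1.1).2
    have h4 : mellin (fdE b L d) z = mellin fdC z - _ := h3
    change mellin (fdE b L d) z + _ = _
    rw [h4, h1.2, mellin_fdC hz, sub_add_cancel]
lemma gamma_res (l : ℕ) : Tendsto (fun t : ℝ => (t : ℂ) * Complex.Gamma (-(l : ℂ) + t))
    (nhdsWithin 0 (Set.Ioi 0)) (nhds ((-1) ^ l / (l.factorial : ℂ))) := by
  have ht0 : Tendsto (fun t : ℝ => (t : ℂ)) (nhdsWithin 0 (Set.Ioi 0)) (nhds 0) := by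
    have := Complex.continuous_ofReal.tendsto 0
    exact this.mono_left nhdsWithin_le_nhds
  induction l with
  | zero =>
    have : Tendsto (fun t : ℝ => (t : ℂ)) (nhdsWithin 0 (Set.Ioi 0)) (nhdsWithin 0 {0}ᶜ) := by
      apply tendsto_nhdsWithin_of_tendsto_nhds_of_eventually_within _ ht0
      filter_upwards [self_mem_nhdsWithin] with t ht
      have : (0:ℝ) < t := ht
      simpa using this.ne'
    have h := tendsto_self_mul_Gamma_nhds_zero.comp this
    simpa [Function.comp_def] using h
  | succ l ih =>
    have hl : (-((l : ℂ) + 1)) ≠ 0 := by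
      rw [neg_ne_zero]; exact_mod_cast Nat.succ_ne_zero l
    have h2 : Tendsto (fun t : ℝ => -((l : ℂ) + 1) + (t : ℂ)) (nhdsWithin 0 (Set.Ioi 0)) (nhds (-((l : ℂ) + 1))) := by
      simpa using ht0.const_add (-((l : ℂ) + 1))
    have h3 := ih.div h2 hl
    have e : (-1 : ℂ) ^ (l + 1) / ((l + 1).factorial : ℂ) = (-1) ^ l / (l.factorial : ℂ) / (-((l : ℂ) + 1)) := by
      rw [Nat.factorial_succ, pow_succ]
      push_cast
      rw [neg_ne_zero] at hl
      have : (l.factorial : ℂ) ≠ 0 := by exact_mod_cast l.factorial_ne_zero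
      field_simp
    rw [e]
    refine h3.congr' ?_
    filter_upwards [Ioo_mem_nhdsGT (zero_lt_one)] with t ht
    have hne : -((l : ℂ) + 1) + (t : ℂ) ≠ 0 := by
      intro h
      have := congrArg Complex.re h
      simp at this
      have h0 : (0:ℝ) ≤ l := by positivity
      linarith [ht.2]
    have := Complex.Gamma_add_one _ hne
    simp only [Pi.div_apply]
    rw [show -(l : ℂ) + (t : ℂ) = -((l : ℂ) + 1) + (t : ℂ) + 1 by ring, this]
    push_cast
    field_simp

lemma fd_coeff {b : ℕ → ℂ} (hb : FdTay b) (l : ℕ) :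
    b l = (-1) ^ l * etaC (-(l : ℂ)) / (l.factorial : ℂ) := by
  have ht0 : Tendsto (fun t : ℝ => (t : ℂ)) (nhdsWithin 0 (Set.Ioi 0)) (nhds 0) := by
    have := Complex.continuous_ofReal.tendsto 0
    exact this.mono_left nhdsWithin_le_nhds
  have hz : Tendsto (fun t : ℝ => -(l : ℂ) + (t : ℂ)) (nhdsWithin 0 (Set.Ioi 0)) (nhds (-(l : ℂ))) := by
    simpa using ht0.const_add (-(l : ℂ))
  have heta : ContinuousAt etaC (-(l : ℂ)) := by
    unfold etaC
    apply DifferentiableAt.continuousAt (𝕜 := ℂ)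
    apply DifferentiableAt.mul
    · apply DifferentiableAt.sub (differentiableAt_const _)
      apply DifferentiableAt.const_cpow (by fun_prop) (Or.inl two_ne_zero)
    · apply differentiableAt_riemannZeta
      intro h
      have := congrArg Complex.re h
      simp at this
      have h0 : (0:ℝ) ≤ l := by positivity
      linarith
  have R : Tendsto (fun t : ℝ => ((t : ℂ) * Complex.Gamma (-(l : ℂ) + t)) * etaC (-(l : ℂ) + t))
      (nhdsWithin 0 (Set.Ioi 0)) (nhds ((-1) ^ l / (l.factorial : ℂ) * etaC (-(l : ℂ)))) :=
    (gamma_res l).mul (heta.tendsto.comp hz)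
  have hE : ContinuousAt (mellin (fdE b (l + 1) 1)) (-(l : ℂ)) :=
    (fdE_diff hb (l + 1) one_pos (by simp)).continuousAt
  have T1 : Tendsto (fun t : ℝ => (t : ℂ) * mellin (fdE b (l + 1) 1) (-(l : ℂ) + t))
      (nhdsWithin 0 (Set.Ioi 0)) (nhds (0 * mellin (fdE b (l + 1) 1) (-(l : ℂ)))) :=
    ht0.mul (hE.tendsto.comp hz)
  have T2 : Tendsto (fun t : ℝ => (t : ℂ) * ∑ j ∈ Finset.range l, b j * (1 / (j + (-(l : ℂ) + t))))
      (nhdsWithin 0 (Set.Ioi 0)) (nhds (0 * ∑ j ∈ Finset.range l, b j * (1 / (j + (-(l : ℂ)))))) := by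
    refine ht0.mul (tendsto_finsetSum _ fun j hj => ?_)
    refine (Tendsto.div tendsto_const_nhds (hz.const_add _) ?_).const_mul _
    intro h
    have hj := Finset.mem_range.1 hj
    have : (j : ℂ) = l := by linear_combination h
    have : j = l := by exact_mod_cast this
    omega
  have T : Tendsto (fun t : ℝ => (t : ℂ) * mellin (fdE b (l + 1) 1) (-(l : ℂ) + t)
      + (t : ℂ) * ∑ j ∈ Finset.range l, b j * (1 / (j + (-(l : ℂ) + t))) + b l)
      (nhdsWithin 0 (Set.Ioi 0)) (nhds (b l)) := by
    simpa using (T1.add T2).add_const (b l)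
  have := tendsto_nhds_unique_of_eventuallyEq T R ?_
  · rw [this]; ring
  · filter_upwards [Ioo_mem_nhdsGT (zero_lt_one)] with t ht
    have htne : (t : ℂ) ≠ 0 := by exact_mod_cast ht.1.ne'
    have hnz : ∀ n : ℤ, (-(l : ℂ) + t) ≠ n := by
      intro n h
      have h1 : (t : ℂ) = ((n + l : ℤ) : ℂ) := by push_cast; linear_combination h
      have h2 : t = ((n + l : ℤ) : ℝ) := by exact_mod_cast h1
      have h3 := ht.1
      have h4 := ht.2
      rw [h2] at h3 h4
      have h5 : (0:ℤ) < n + l := by exact_mod_cast h3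
      have h6 : n + l < (1:ℤ) := by exact_mod_cast h4
      omega
    have := fdE_mellin hb (l + 1) one_pos (s := -(l : ℂ) + t) (by simp; linarith [ht.1]) hnz
    rw [mul_assoc, ← this, Finset.sum_range_succ]
    simp only [ofReal_one, Complex.one_cpow]
    rw [show (l : ℂ) + (-(l : ℂ) + t) = t by ring]
    field_simp
    ring


lemma hasMellin_polyIoi (b : ℕ → ℂ) (L : ℕ) {d : ℝ} (hd : 0 < d) {s : ℂ}
    (hs : ∀ l : ℕ, l < L → s.re < -(l : ℝ)) :
    HasMellin ((Set.Ioi d).indicator (fun y : ℝ => ∑ l ∈ Finset.range L, b l * (y : ℂ) ^ l)) s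
      (- ∑ l ∈ Finset.range L, b l * ((d : ℂ) ^ (l + s) / (l + s))) := by
  have e : Set.EqOn (fun y : ℝ => (y : ℂ) ^ (s - 1) • (Set.Ioi d).indicator
      (fun y : ℝ => ∑ l ∈ Finset.range L, b l * (y : ℂ) ^ l) y) ((Set.Ioi d).indicator
      (fun y : ℝ => ∑ l ∈ Finset.range L, b l * (y : ℂ) ^ ((s + l) - 1))) (Set.Ioi 0) := by
    intro y hy0
    by_cases hy : y ∈ Set.Ioi d
    · simp only [Set.indicator_of_mem hy, smul_eq_mul, Finset.mul_sum]
      refine Finset.sum_congr rfl fun l _ => ?_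
      rw [← cpow_mul_pow hy0]
      ring
    · simp [Set.indicator_of_notMem hy]
  have hre : ∀ l ∈ Finset.range L, (s + l - 1).re < -1 := by
    intro l hl
    have := hs l (Finset.mem_range.1 hl)
    simp; linarith
  have hi : ∀ l ∈ Finset.range L, IntegrableOn (fun y : ℝ => b l * (y : ℂ) ^ ((s + l) - 1)) (Set.Ioi d) :=
    fun l hl => (integrableOn_Ioi_cpow_of_lt (hre l hl) hd).const_mul _
  have hsub : Set.Ioi (0:ℝ) ∩ Set.Ioi d = Set.Ioi d :=
    Set.inter_eq_right.2 fun x hx => hd.trans hx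
  constructor
  · rw [MellinConvergent, integrableOn_congr_fun e measurableSet_Ioi]
    rw [integrableOn_indicator_iff measurableSet_Ioi, Set.inter_comm, hsub]
    exact integrable_finsetSum _ hi
  · rw [mellin, setIntegral_congr_fun measurableSet_Ioi e]
    rw [setIntegral_indicator measurableSet_Ioi, hsub, integral_finsetSum _ hi, ← Finset.sum_neg_distrib]
    refine Finset.sum_congr rfl fun l hl => ?_
    rw [integral_const_mul, integral_Ioi_cpow_of_lt (hre l hl) hd, sub_add_cancel, add_comm s]
    ring

/-- Taylor remainder -/
noncomputable def fdRem (b : ℕ → ℂ) (L : ℕ) (y : ℝ) : ℂ :=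
  fdC y - ∑ l ∈ Finset.range L, b l * (y : ℂ) ^ l

lemma continuous_fdRem (b : ℕ → ℂ) (L : ℕ) : Continuous (fdRem b L) := by
  unfold fdRem
  have := continuous_fdC
  fun_prop

lemma hasMellin_fdRem {b : ℕ → ℂ} (hb : FdTay b) (L : ℕ) {s : ℂ} (hs0 : -(L : ℝ) < s.re)
    (hs : ∀ l : ℕ, l < L → s.re < -(l : ℝ)) (hsZ : ∀ n : ℤ, s ≠ n) :
    HasMellin (fdRem b L) s (Complex.Gamma s * etaC s) := by
  have h1 := fdE_conv hb L one_pos hs0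
  have h2 := hasMellin_polyIoi b L one_pos hs
  have h3 := hasMellin_sub h1 h2.1
  have e : Set.EqOn (fun y : ℝ => (y : ℂ) ^ (s - 1) • fdRem b L y)
    (fun y : ℝ => (y : ℂ) ^ (s - 1) • (fdE b L 1 y - (Set.Ioi 1).indicator
      (fun y : ℝ => ∑ l ∈ Finset.range L, b l * (y : ℂ) ^ l) y)) (Set.Ioi 0) := by
    intro y hy
    have hy : 0 < y := hy
    simp only [fdRem, fdE]
    congr 1
    rcases le_or_gt y 1 with h | h
    · rw [Set.indicator_of_mem (show y ∈ Set.Ioc 0 1 from ⟨hy, h⟩), Set.indicator_of_notMem (by simpa using h)]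
      simp
    · rw [Set.indicator_of_notMem (fun h' => not_lt.2 h'.2 h), Set.indicator_of_mem (by simpa using h)]
      simp
  constructor
  · rw [MellinConvergent, integrableOn_congr_fun e measurableSet_Ioi]
    exact h3.1
  · rw [mellin, setIntegral_congr_fun measurableSet_Ioi e]
    change mellin _ s = _
    rw [h3.2, h2.2, sub_neg_eq_add, fdE_mellin hb L one_pos hs0 hsZ]

lemma theta_nonint {θ : ℝ} (hθ : ∀ n : ℤ, θ ≠ n) (t : ℝ) (n : ℤ) : (-(θ : ℂ) + t * I) ≠ n := by
  intro h
  have := congrArg Complex.re h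
  simp at this
  apply hθ (-n)
  push_cast
  linarith

lemma fd_expand {b : ℕ → ℂ} (hb : FdTay b) (L : ℕ) {θ : ℝ} (hθ : ∀ n : ℤ, θ ≠ n) (hL1 : θ < L)
    (hL2 : ∀ l : ℕ, l < L → (l : ℝ) < θ) {y : ℝ} (hy : 0 < y) :
    fdRem b L y = (1 / (2 * (Real.pi : ℂ))) * ∫ t : ℝ,
      (Complex.Gamma (-(θ : ℂ) - t * I) * etaC (-(θ : ℂ) - t * I)) * (y : ℂ) ^ ((θ : ℂ) + t * I) := by
  have hM : ∀ t : ℝ, HasMellin (fdRem b L) (-(θ : ℂ) + t * I)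
      (Complex.Gamma (-(θ : ℂ) + t * I) * etaC (-(θ : ℂ) + t * I)) := by
    intro t
    refine hasMellin_fdRem hb L ?_ ?_ (theta_nonint hθ t)
    · simpa using hL1
    · intro l hl
      simpa using hL2 l hl
  have hv : Integrable (fun t : ℝ => Complex.Gamma (-(θ : ℂ) + t * I) * etaC (-(θ : ℂ) + t * I)) := by
    have := (vert_integrable θ hθ).comp_neg
    simpa using this
  have h := mellinInv_mellin_eq (-θ) (fdRem b L) hy ?_ ?_ (continuous_fdRem b L).continuousAt
  · rw [← h, mellinInv]
    rw [← integral_neg_eq_self]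
    simp only [Complex.real_smul, smul_eq_mul]
    push_cast
    congr 1
    refine integral_congr_ae (Eventually.of_forall fun t => ?_)
    have := (hM (-t)).2
    simp only [ofReal_neg, neg_mul, ← sub_eq_add_neg] at this ⊢
    rw [this, mul_comm]
    congr 2
    ring
  · simpa using (hM 0).1
  · rw [VerticalIntegrable]
    refine hv.congr (Eventually.of_forall fun t => ?_)
    simp only [ofReal_neg]
    rw [(hM t).2]

lemma fub {S : Set ℝ} (hS : MeasurableSet S) {h : ℝ → ℝ} (hh : Measurable h) (hpos : ∀ x ∈ S, 0 < h x)
    {r : ℝ → ℂ} (hr : AEStronglyMeasurable r (volume.restrict S)) {θ : ℝ}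
    (hint : IntegrableOn (fun x => h x ^ θ * ‖r x‖) S) {β : ℝ} (hβ : 0 < β)
    {Φ : ℝ → ℂ} (hΦ : Integrable Φ) :
    Integrable (fun t : ℝ => Φ t * (β : ℂ) ^ ((θ : ℂ) + t * I) *
      ∫ x in S, (h x : ℂ) ^ ((θ : ℂ) + t * I) * r x) ∧
    IntegrableOn (fun x => r x * ∫ t : ℝ, Φ t * ((β * h x : ℝ) : ℂ) ^ ((θ : ℂ) + t * I)) S ∧
    ∫ x in S, r x * ∫ t : ℝ, Φ t * ((β * h x : ℝ) : ℂ) ^ ((θ : ℂ) + t * I)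
      = ∫ t : ℝ, Φ t * (β : ℂ) ^ ((θ : ℂ) + t * I) *
      ∫ x in S, (h x : ℂ) ^ ((θ : ℂ) + t * I) * r x := by
  set K : ℝ → ℝ → ℂ := fun x t => r x * (Φ t * ((β * h x : ℝ) : ℂ) ^ ((θ : ℂ) + t * I)) with hK
  have hae : ∀ᵐ p ∂((volume.restrict S).prod (volume : Measure ℝ)), 0 < h p.1 := by
    have : ∀ᵐ x ∂(volume.restrict S), 0 < h x := by
      filter_upwards [ae_restrict_mem hS] with x hx using hpos x hx
    exact Measure.quasiMeasurePreserving_fst.ae this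
  have hKint : Integrable (Function.uncurry K) ((volume.restrict S).prod volume) := by
    have hdom : Integrable (fun p : ℝ × ℝ => (β ^ θ * (h p.1 ^ θ * ‖r p.1‖)) * ‖Φ p.2‖)
        ((volume.restrict S).prod volume) := (hint.const_mul (β ^ θ)).mul_prod hΦ.norm
    refine hdom.mono' ?_ ?_
    · refine AEStronglyMeasurable.mul hr.comp_fst (AEStronglyMeasurable.mul hΦ.1.comp_snd ?_)
      apply Measurable.aestronglyMeasurable
      have : Measurable (fun p : ℝ × ℝ => β * h p.1) := (hh.comp measurable_fst).const_mul β
      apply Measurable.pow (Complex.measurable_ofReal.comp this)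
      exact (Complex.measurable_ofReal.comp measurable_snd).mul_const I |>.const_add _
    · filter_upwards [hae] with p hp
      simp only [Function.uncurry, hK]
      rw [norm_mul, norm_mul, Complex.norm_cpow_eq_rpow_re_of_pos (by positivity)]
      simp
      rw [Real.mul_rpow hβ.le hp.le]
      apply le_of_eq
      ring
  have e : ∀ t : ℝ, ∫ x in S, K x t = Φ t * (β : ℂ) ^ ((θ : ℂ) + t * I) *
      ∫ x in S, (h x : ℂ) ^ ((θ : ℂ) + t * I) * r x := by
    intro t
    rw [← integral_const_mul]
    refine setIntegral_congr_fun hS fun x hx => ?_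
    simp only [hK]
    rw [Complex.ofReal_mul, Complex.mul_cpow_ofReal_nonneg hβ.le (hpos x hx).le]
    ring
  have e2 : ∀ x : ℝ, ∫ t, K x t = r x * ∫ t : ℝ, Φ t * ((β * h x : ℝ) : ℂ) ^ ((θ : ℂ) + t * I) := by
    intro x
    simp only [hK]
    rw [integral_const_mul]
  refine ⟨?_, ?_, ?_⟩
  · simp only [← e]
    exact hKint.integral_prod_right
  · simp only [← e2]
    exact hKint.integral_prod_left
  · simp only [← e, ← e2]
    exact integral_integral_swap hKint

lemma power_lemma {b : ℕ → ℂ} (hb : FdTay b) (L : ℕ) {θ : ℝ} (hθ : ∀ n : ℤ, θ ≠ n) (hL1 : θ < L)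
    (hL2 : ∀ l : ℕ, l < L → (l : ℝ) < θ) {β δ : ℝ} (hβ : 0 < β) (hδ : 0 < δ) {γ : ℂ}
    (hγ : -θ < γ.re) (hγZ : ∀ n : ℤ, γ ≠ n) :
    IntegrableOn (fun x : ℝ => (x : ℂ) ^ (γ - 1) * fdC (β * x)) (Set.Ioi δ) ∧
    Integrable (fun t : ℝ => (Complex.Gamma (-(θ : ℂ) - t * I) * etaC (-(θ : ℂ) - t * I)) *
        (β : ℂ) ^ ((θ : ℂ) + t * I) * ((δ : ℂ) ^ ((θ : ℂ) + t * I + γ) / ((θ : ℂ) + t * I + γ))) ∧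
    ∫ x in Set.Ioi δ, (x : ℂ) ^ (γ - 1) * fdC (β * x)
      = (β : ℂ) ^ (-γ) * (Complex.Gamma γ * etaC γ)
        - ∑ l ∈ Finset.range L, b l * (β : ℂ) ^ l * ((δ : ℂ) ^ (l + γ) / (l + γ))
        - (1 / (2 * (Real.pi : ℂ))) * ∫ t : ℝ,
          (Complex.Gamma (-(θ : ℂ) - t * I) * etaC (-(θ : ℂ) - t * I)) *
          (β : ℂ) ^ ((θ : ℂ) + t * I) * ((δ : ℂ) ^ ((θ : ℂ) + t * I + γ) / ((θ : ℂ) + t * I + γ)) := by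
  have hγL : -(L : ℝ) < γ.re := by linarith
  have hd : 0 < β * δ := by positivity
  have hbc : (β : ℂ) ≠ 0 := by exact_mod_cast hβ.ne'
  have hdc : (δ : ℂ) ≠ 0 := by exact_mod_cast hδ.ne'
  have hconv : MellinConvergent (fun x => fdE b L (β * δ) (β * x)) γ :=
    (MellinConvergent.comp_mul_left hβ).2 (fdE_conv hb L hd hγL)
  have hval := mellin_comp_mul_left (fdE b L (β * δ)) γ hβ
  have hmain := fdE_mellin hb L hd hγL hγZ
  have eIoc : Set.EqOn (fun x : ℝ => (x : ℂ) ^ (γ - 1) • fdE b L (β * δ) (β * x))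
      (fun x : ℝ => (x : ℂ) ^ (γ - 1) * fdRem b L (β * x)) (Set.Ioc 0 δ) := by
    intro x hx
    have : β * x ∈ Set.Ioc 0 (β * δ) := ⟨mul_pos hβ hx.1, by gcongr; exact hx.2⟩
    simp only [fdE, fdRem, Set.indicator_of_mem this, smul_eq_mul]
  have eIoi : Set.EqOn (fun x : ℝ => (x : ℂ) ^ (γ - 1) • fdE b L (β * δ) (β * x))
      (fun x : ℝ => (x : ℂ) ^ (γ - 1) * fdC (β * x)) (Set.Ioi δ) := by
    intro x hx
    have : β * x ∉ Set.Ioc 0 (β * δ) := by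
      intro h
      have h1 := h.2
      have h2 : β * δ < β * x := by gcongr; exact hx
      linarith
    simp only [fdE, Set.indicator_of_notMem this, smul_eq_mul, sub_zero]
  have hun : Set.Ioc 0 δ ∪ Set.Ioi δ = Set.Ioi 0 := Set.Ioc_union_Ioi_eq_Ioi hδ.le
  have i1 : IntegrableOn (fun x : ℝ => (x : ℂ) ^ (γ - 1) • fdE b L (β * δ) (β * x)) (Set.Ioc 0 δ) :=
    IntegrableOn.mono_set hconv (fun x hx => hx.1)
  have i2 : IntegrableOn (fun x : ℝ => (x : ℂ) ^ (γ - 1) • fdE b L (β * δ) (β * x)) (Set.Ioi δ) :=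
    IntegrableOn.mono_set hconv (fun x hx => hδ.trans hx)
  have hsplit : mellin (fun x => fdE b L (β * δ) (β * x)) γ
      = (∫ x in Set.Ioc 0 δ, (x : ℂ) ^ (γ - 1) * fdRem b L (β * x))
        + ∫ x in Set.Ioi δ, (x : ℂ) ^ (γ - 1) * fdC (β * x) := by
    rw [mellin, ← hun, setIntegral_union (Set.Ioc_disjoint_Ioi le_rfl) measurableSet_Ioi i1 i2,
      setIntegral_congr_fun measurableSet_Ioc eIoc, setIntegral_congr_fun measurableSet_Ioi eIoi]
  have hF := fub (S := Set.Ioc 0 δ) measurableSet_Ioc (h := fun x => x) measurable_id (fun x hx => hx.1)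
    (r := fun x : ℝ => (x : ℂ) ^ (γ - 1)) (θ := θ)
    ((Complex.measurable_ofReal.pow_const _).aestronglyMeasurable) ?_ hβ (vert_integrable θ hθ)
  · have e3 : ∀ t : ℝ, ∫ x in Set.Ioc 0 δ, (x : ℂ) ^ ((θ : ℂ) + t * I) * (x : ℂ) ^ (γ - 1)
        = (δ : ℂ) ^ ((θ : ℂ) + t * I + γ) / ((θ : ℂ) + t * I + γ) := by
      intro t
      rw [← (cpow_Ioc (w := (θ : ℂ) + t * I + γ) (by simp; linarith) hδ).2]
      refine setIntegral_congr_fun measurableSet_Ioc fun x hx => ?_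
      rw [← Complex.cpow_add _ _ (by exact_mod_cast hx.1.ne')]
      congr 1
      ring
    simp only [e3] at hF
    obtain ⟨f1, -, f3⟩ := hF
    refine ⟨(integrableOn_congr_fun eIoi measurableSet_Ioi).1 i2, f1, ?_⟩
    rw [← f3]
    have e4 : ∫ x in Set.Ioc 0 δ, (x : ℂ) ^ (γ - 1) * fdRem b L (β * x) = (1 / (2 * (Real.pi : ℂ))) *
        ∫ x in Set.Ioc 0 δ, (x : ℂ) ^ (γ - 1) * ∫ t : ℝ,
      (Complex.Gamma (-(θ : ℂ) - t * I) * etaC (-(θ : ℂ) - t * I)) * ((β * x : ℝ) : ℂ) ^ ((θ : ℂ) + t * I) := by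
      rw [← integral_const_mul]
      refine setIntegral_congr_fun measurableSet_Ioc fun x hx => ?_
      rw [fd_expand hb L hθ hL1 hL2 (mul_pos hβ hx.1)]
      ring
    rw [← e4]
    have e5 : (β : ℂ) ^ (-γ) * ∑ l ∈ Finset.range L, b l * (((β * δ : ℝ) : ℂ) ^ (l + γ) / (l + γ))
        = ∑ l ∈ Finset.range L, b l * (β : ℂ) ^ l * ((δ : ℂ) ^ (l + γ) / (l + γ)) := by
      rw [Finset.mul_sum]
      refine Finset.sum_congr rfl fun l _ => ?_
      rw [Complex.ofReal_mul, Complex.mul_cpow_ofReal_nonneg hβ.le hδ.le]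
      have : (β : ℂ) ^ l = (β : ℂ) ^ (-γ) * (β : ℂ) ^ (l + γ) := by
        rw [← Complex.cpow_add _ _ hbc, ← Complex.cpow_natCast]
        congr 1
        ring
      rw [this]
      ring
    rw [← e5, ← hmain]
    rw [smul_eq_mul] at hval
    rw [hval] at hsplit
    linear_combination -hsplit
  · have h1 := (cpow_Ioc (w := (θ : ℂ) + γ) (by simp; linarith) hδ).1.norm
    refine (integrableOn_congr_fun ?_ measurableSet_Ioc).1 h1
    intro x hx
    simp only
    rw [Complex.norm_cpow_eq_rpow_re_of_pos hx.1, Complex.norm_cpow_eq_rpow_re_of_pos hx.1,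
      ← Real.rpow_add hx.1]
    congr 1
    simp
    ring


lemma choose_gamma (z : ℂ) (hz : ∀ k : ℕ, z ≠ -k) (n : ℕ) :
    Ring.choose (z + n - 1) n = Complex.Gamma (z + n) / Complex.Gamma z / (n.factorial : ℂ) := by
  have hn : (n.factorial : ℂ) ≠ 0 := by exact_mod_cast n.factorial_ne_zero
  rw [Complex.Gamma_add_nat_div_Gamma_eq z hz, eq_div_iff hn, ← Ring.multichoose_eq,
    ← Polynomial.ascPochhammer_smeval_eq_eval, ← Ring.factorial_nsmul_multichoose_eq_ascPochhammer,
    nsmul_eq_mul, mul_comm]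

lemma binom_asymp (a : ℂ) (M : ℕ) {μ : ℝ} (hμ : 0 < μ) :
    (fun ω : ℝ => (ω : ℂ) ^ a - ∑ n ∈ Finset.range M,
      Ring.choose a n * (μ : ℂ) ^ n * ((ω - μ : ℝ) : ℂ) ^ (a - (n : ℂ)))
      =O[atTop] fun ω : ℝ => (ω - μ) ^ (a.re - (M : ℝ)) := by
  have h := (Complex.one_add_cpow_hasFPowerSeriesAt_zero (a := a)).isBigO_sub_partialSum_pow M
  have ht : Tendsto (fun ω : ℝ => ((μ / (ω - μ) : ℝ) : ℂ)) atTop (nhds 0) := by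
    have h1 : Tendsto (fun ω : ℝ => μ / (ω - μ)) atTop (nhds 0) :=
      tendsto_const_nhds.div_atTop (tendsto_atTop_add_const_right _ (-μ) tendsto_id)
    have := (Complex.continuous_ofReal.tendsto 0).comp h1
    simpa [Function.comp_def] using this
  have h2 := h.comp_tendsto ht
  have hx : (fun ω : ℝ => ((ω - μ : ℝ) : ℂ) ^ a) =O[atTop] fun ω : ℝ => (ω - μ) ^ a.re := by
    refine Asymptotics.IsBigO.of_bound 1 ?_
    filter_upwards [eventually_gt_atTop μ] with ω hω
    rw [Complex.norm_cpow_eq_rpow_re_of_pos (sub_pos.2 hω), one_mul]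
    exact le_abs_self _
  have h3 := hx.mul h2
  refine (h3.congr' ?_ ?_).trans (Asymptotics.isBigO_const_mul_self (μ ^ M) _ _)
  · filter_upwards [eventually_gt_atTop μ] with ω hω
    have hp := sub_pos.2 hω
    have hne : ((ω - μ : ℝ) : ℂ) ≠ 0 := by exact_mod_cast hp.ne'
    have e1 : (1 + ((μ / (ω - μ) : ℝ) : ℂ)) = ((ω / (ω - μ) : ℝ) : ℂ) := by
      rw [← Complex.ofReal_one, ← Complex.ofReal_add]
      congr 1
      field_simp
      ring
    have e2 : ((ω - μ : ℝ) : ℂ) ^ a * ((ω / (ω - μ) : ℝ) : ℂ) ^ a = (ω : ℂ) ^ a := by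
      rw [← Complex.mul_cpow_ofReal_nonneg hp.le (div_nonneg (hμ.trans hω).le hp.le),
        ← Complex.ofReal_mul]
      congr 2
      field_simp
    simp only [Function.comp, zero_add]
    rw [e1, mul_sub, e2, FormalMultilinearSeries.partialSum, Finset.mul_sum]
    congr 1
    refine Finset.sum_congr rfl fun n _ => ?_
    rw [binomialSeries_apply, List.ofFn_const, List.prod_replicate, smul_eq_mul,
      Complex.cpow_sub _ _ hne, Complex.cpow_natCast, Complex.ofReal_div, div_pow]
    ring
  · filter_upwards [eventually_gt_atTop μ] with ω hω
    have hp := sub_pos.2 hω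
    simp only [Function.comp, Complex.norm_real, Real.norm_eq_abs]
    rw [abs_of_pos (div_pos hμ hp), Real.rpow_sub hp, Real.rpow_natCast, div_pow]
    ring

lemma shift_asymp (e μ : ℝ) :
    (fun ω : ℝ => ω ^ e) =O[atTop] fun ω : ℝ => (ω - μ) ^ e := by
  have ht : Tendsto (fun ω : ℝ => ω / (ω - μ)) atTop (nhds 1) := by
    have h1 : Tendsto (fun ω : ℝ => 1 + μ / (ω - μ)) atTop (nhds (1 + 0)) :=
      tendsto_const_nhds.add
        (tendsto_const_nhds.div_atTop (tendsto_atTop_add_const_right _ (-μ) tendsto_id))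
    rw [add_zero] at h1
    refine h1.congr' ?_
    filter_upwards [eventually_gt_atTop μ] with ω hω
    have hp := sub_pos.2 hω
    field_simp
    ring
  have h2 : Tendsto (fun ω : ℝ => (ω / (ω - μ)) ^ e) atTop (nhds (1 ^ e)) :=
    ht.rpow_const (Or.inl one_ne_zero)
  have h3 := (h2.isBigO_one ℝ).mul (Asymptotics.isBigO_refl (fun ω : ℝ => (ω - μ) ^ e) atTop)
  refine h3.congr' ?_ (by simp)
  filter_upwards [eventually_gt_atTop μ, eventually_gt_atTop 0] with ω hω h0
  have hp := sub_pos.2 hω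
  rw [← Real.mul_rpow (div_nonneg h0.le hp.le) hp.le]
  congr 1
  field_simp

lemma r_asymp (α : ℂ) (hα : ∀ n : ℤ, α ≠ (n : ℂ)) (N : ℕ) (μ : ℝ) (hμ0 : 0 < μ)
    (c : ℕ → ℂ) (g : ℝ → ℂ)
    (hasymp : (fun ω : ℝ => g ω - ∑ k ∈ Finset.range (N + 1), c k * (ω : ℂ) ^ (α - (k : ℂ)))
      =O[Filter.atTop] fun ω : ℝ => ω ^ (α.re - (N : ℝ) - 1))
    (a : ℕ → ℂ)
    (ha : ∀ m : ℕ, a m = ∑ n ∈ Finset.range (m + 1),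
      c (m - n) * (Complex.Gamma (α + 1 - (m : ℂ) + (n : ℂ)) / Complex.Gamma (α + 1 - (m : ℂ)))
        * (μ : ℂ) ^ n / (n.factorial : ℂ)) :
    (fun ω : ℝ => g ω - ∑ m ∈ Finset.range (N + 1), a m * ((ω - μ : ℝ) : ℂ) ^ (α - (m : ℂ)))
      =O[atTop] fun ω : ℝ => (ω - μ) ^ (α.re - (N : ℝ) - 1) := by
  have h1 := hasymp.trans (shift_asymp (α.re - (N : ℝ) - 1) μ)
  have h2 : (fun ω : ℝ => ∑ k ∈ Finset.range (N + 1), c k * ((ω : ℂ) ^ (α - (k : ℂ)) -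
      ∑ n ∈ Finset.range (N + 1 - k),
      Ring.choose (α - (k : ℂ)) n * (μ : ℂ) ^ n * ((ω - μ : ℝ) : ℂ) ^ (α - (k : ℂ) - (n : ℂ))))
      =O[atTop] fun ω : ℝ => (ω - μ) ^ (α.re - (N : ℝ) - 1) := by
    refine Asymptotics.IsBigO.fun_sum fun k hk => Asymptotics.IsBigO.const_mul_left ?_ _
    have := binom_asymp (α - (k : ℂ)) (N + 1 - k) hμ0
    rw [Finset.mem_range] at hk
    convert! this using 3
    rw [Nat.cast_sub (by omega)]
    simp
    ring
  have key : ∀ x : ℂ, ∑ m ∈ Finset.range (N + 1), a m * x ^ (α - (m : ℂ)) =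
      ∑ k ∈ Finset.range (N + 1), c k * ∑ n ∈ Finset.range (N + 1 - k),
      Ring.choose (α - (k : ℂ)) n * (μ : ℂ) ^ n * x ^ (α - (k : ℂ) - (n : ℂ)) := by
    intro x
    simp only [Finset.mul_sum]
    rw [← Finset.sum_range_diag_flip (N + 1) (fun k n => c k *
      (Ring.choose (α - (k : ℂ)) n * (μ : ℂ) ^ n * x ^ (α - (k : ℂ) - (n : ℂ))))]
    refine Finset.sum_congr rfl fun m _ => ?_
    rw [ha, ← Finset.sum_flip, Finset.sum_mul]
    refine Finset.sum_congr rfl fun n hn => ?_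
    rw [Finset.mem_range] at hn
    have hnm : n ≤ m := by omega
    have hc : ((m - n : ℕ) : ℂ) = (m : ℂ) - n := by rw [Nat.cast_sub hnm]
    have := choose_gamma (α + 1 - m) (fun k hk => hα (m - 1 - k) (by
      push_cast; linear_combination hk)) (m - n)
    rw [show α + 1 - (m : ℂ) + ((m - n : ℕ) : ℂ) - 1 = α - n by rw [hc]; ring] at this
    rw [Nat.sub_sub_self hnm, this, show α - (n : ℂ) - ((m - n : ℕ) : ℂ) = α - m by rw [hc]; ring]
    ring
  refine (h1.add h2).congr_left fun ω => ?_
  rw [key]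
  simp only [mul_sub, Finset.sum_sub_distrib]
  ring

lemma r_integrable {r : ℝ → ℂ} {ωc μ e p : ℝ} (hμ : μ < ωc)
    (hloc : LocallyIntegrableOn r (Set.Ici ωc))
    (hO : r =O[atTop] fun ω : ℝ => (ω - μ) ^ e) (hp : p + e < -1) :
    IntegrableOn (fun ω : ℝ => (ω - μ) ^ p * ‖r ω‖) (Set.Ici ωc) := by
  have hl : LocallyIntegrableOn (fun ω : ℝ => (ω - μ) ^ p * ‖r ω‖) (Set.Ici ωc) := by
    refine LocallyIntegrableOn.continuousOn_mul hloc.norm ?_ isClosed_Ici.isLocallyClosed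
    refine ContinuousOn.rpow_const (by fun_prop) fun x hx => Or.inl ?_
    exact (sub_pos.2 (hμ.trans_le hx)).ne'
  have h1 : (fun ω : ℝ => (ω - μ) ^ (p + e)) =O[atTop] fun ω : ℝ => ω ^ (p + e) := by
    have := (shift_asymp (p + e) (-μ)).comp_tendsto
      (tendsto_atTop_add_const_right atTop (-μ) tendsto_id)
    refine this.congr (fun x => ?_) (fun x => ?_) <;> simp [sub_eq_add_neg]
  have h2 : (fun ω : ℝ => (ω - μ) ^ p * ‖r ω‖) =O[atTop] fun ω : ℝ => (ω - μ) ^ (p + e) := by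
    refine ((Asymptotics.isBigO_refl (fun ω : ℝ => (ω - μ) ^ p) atTop).mul hO.norm_left).congr'
      EventuallyEq.rfl ?_
    filter_upwards [eventually_gt_atTop μ] with ω hω
    rw [Real.rpow_add (sub_pos.2 hω)]
  exact hl.integrableOn_of_isBigO_atTop (h2.trans h1)
    ⟨Set.Ioi 1, Ioi_mem_atTop 1, integrableOn_Ioi_rpow_of_lt hp one_pos⟩


lemma rem_lemma {b : ℕ → ℂ} (hb : FdTay b) (L : ℕ) {θ : ℝ} (hθ : ∀ n : ℤ, θ ≠ n) (hL1 : θ < L)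
    (hL2 : ∀ l : ℕ, l < L → (l : ℝ) < θ) {β ωc μ e : ℝ} (hβ : 0 < β) (hμ : μ < ωc) {r : ℝ → ℂ}
    (hr : Measurable r) (hloc : LocallyIntegrableOn r (Set.Ici ωc))
    (hO : r =O[atTop] fun ω : ℝ => (ω - μ) ^ e) (hp : θ + e < -1) :
    IntegrableOn (fun ω : ℝ => r ω * fdC (β * (ω - μ))) (Set.Ici ωc) ∧
    Integrable (fun t : ℝ => (Complex.Gamma (-(θ : ℂ) - t * I) * etaC (-(θ : ℂ) - t * I)) *
        (β : ℂ) ^ ((θ : ℂ) + t * I) *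
          ∫ ω in Set.Ici ωc, ((ω - μ : ℝ) : ℂ) ^ ((θ : ℂ) + t * I) * r ω) ∧
    ∫ ω in Set.Ici ωc, r ω * fdC (β * (ω - μ))
      = (∑ l ∈ Finset.range L, b l * (β : ℂ) ^ l *
          ∫ ω in Set.Ici ωc, ((ω - μ : ℝ) : ℂ) ^ (l : ℂ) * r ω)
        + (1 / (2 * (Real.pi : ℂ))) * ∫ t : ℝ,
          (Complex.Gamma (-(θ : ℂ) - t * I) * etaC (-(θ : ℂ) - t * I)) *
          (β : ℂ) ^ ((θ : ℂ) + t * I) *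
            ∫ ω in Set.Ici ωc, ((ω - μ : ℝ) : ℂ) ^ ((θ : ℂ) + t * I) * r ω := by
  have hpos : ∀ ω ∈ Set.Ici ωc, 0 < ω - μ := fun ω hω => sub_pos.2 (hμ.trans_le hω)
  obtain ⟨f1, f2, f3⟩ := fub (S := Set.Ici ωc) measurableSet_Ici (h := fun ω => ω - μ)
    (by fun_prop) hpos hr.aestronglyMeasurable (r_integrable hμ hloc hO hp) hβ
    (vert_integrable θ hθ)
  have i1 : ∀ l ∈ Finset.range L, IntegrableOn
      (fun ω : ℝ => b l * (β : ℂ) ^ l * (((ω - μ : ℝ) : ℂ) ^ (l : ℂ) * r ω)) (Set.Ici ωc) := by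
    intro l hl
    refine Integrable.const_mul ?_ _
    have hl' := hL2 l (Finset.mem_range.1 hl)
    refine (r_integrable (p := l) hμ hloc hO (by linarith)).mono' ?_ ?_
    · refine Measurable.aestronglyMeasurable ?_
      exact ((Complex.measurable_ofReal.comp (by fun_prop)).pow_const _).mul hr
    · refine (ae_restrict_iff' measurableSet_Ici).2 (Eventually.of_forall fun ω hω => ?_)
      rw [norm_mul, Complex.norm_cpow_eq_rpow_re_of_pos (hpos ω hω), Complex.natCast_re]
  have eq : ∀ ω ∈ Set.Ici ωc, r ω * fdC (β * (ω - μ)) =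
      (∑ l ∈ Finset.range L, b l * (β : ℂ) ^ l * (((ω - μ : ℝ) : ℂ) ^ (l : ℂ) * r ω)) +
      (1 / (2 * (Real.pi : ℂ))) * (r ω * ∫ t : ℝ,
        (Complex.Gamma (-(θ : ℂ) - t * I) * etaC (-(θ : ℂ) - t * I)) *
          ((β * (ω - μ) : ℝ) : ℂ) ^ ((θ : ℂ) + t * I)) := by
    intro ω hω
    have h1 := fd_expand hb L hθ hL1 hL2 (mul_pos hβ (hpos ω hω))
    have h2 : fdC (β * (ω - μ)) = (∑ l ∈ Finset.range L, b l * ((β * (ω - μ) : ℝ) : ℂ) ^ l) +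
        fdRem b L (β * (ω - μ)) := by
      rw [fdRem]; ring
    rw [h2, h1, mul_add, Finset.mul_sum]
    congr 1
    · refine Finset.sum_congr rfl fun l _ => ?_
      rw [Complex.cpow_natCast, Complex.ofReal_mul, mul_pow]
      ring
    · ring
  have i2 := (integrable_finsetSum _ i1).add (f2.const_mul (1 / (2 * (Real.pi : ℂ))))
  refine ⟨(integrableOn_congr_fun eq measurableSet_Ici).2 i2, f1, ?_⟩
  rw [setIntegral_congr_fun measurableSet_Ici eq,
    integral_add (integrable_finsetSum _ i1) (f2.const_mul (1 / (2 * (Real.pi : ℂ)))),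
    integral_finsetSum _ i1, integral_const_mul, f3]
  simp only [integral_const_mul]

lemma power_shift {f : ℝ → ℂ} {ωc μ : ℝ} :
    (IntegrableOn (fun ω : ℝ => f (ω - μ)) (Set.Ici ωc) ↔ IntegrableOn f (Set.Ioi (ωc - μ))) ∧
    ∫ ω in Set.Ici ωc, f (ω - μ) = ∫ x in Set.Ioi (ωc - μ), f x := by
  have hm := measurePreserving_sub_right (volume : Measure ℝ) μ
  have he : MeasurableEmbedding (fun ω : ℝ => ω - μ) := measurableEmbedding_subRight μ
  have hs : (fun ω : ℝ => ω - μ) ⁻¹' (Set.Ioi (ωc - μ)) = Set.Ioi ωc := by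
    ext x; simp
  constructor
  · have := hm.integrableOn_comp_preimage he (f := f) (s := Set.Ioi (ωc - μ))
    rw [integrableOn_Ici_iff_integrableOn_Ioi, ← this, hs]
    rfl
  · have := hm.setIntegral_preimage_emb he f (Set.Ioi (ωc - μ))
    rw [integral_Ici_eq_integral_Ioi, ← this, hs]

lemma power_lemma2 {b : ℕ → ℂ} (hb : FdTay b) (L : ℕ) {θ : ℝ} (hθ : ∀ n : ℤ, θ ≠ n) (hL1 : θ < L)
    (hL2 : ∀ l : ℕ, l < L → (l : ℝ) < θ) {β ωc μ : ℝ} (hβ : 0 < β) (hμ : μ < ωc) {α : ℂ}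
    (hα : ∀ n : ℤ, α ≠ n) (m : ℕ) (hm : (m : ℝ) - α.re - 1 < θ) :
    IntegrableOn (fun ω : ℝ => ((ω - μ : ℝ) : ℂ) ^ (α - (m : ℂ)) * fdC (β * (ω - μ)))
      (Set.Ici ωc) ∧
    Integrable (fun t : ℝ => (Complex.Gamma (-(θ : ℂ) - t * I) * etaC (-(θ : ℂ) - t * I)) *
        (β : ℂ) ^ ((θ : ℂ) + t * I) * (((ωc - μ : ℝ) : ℂ) ^ ((θ : ℂ) + t * I + α + 1 - (m : ℂ))
          / ((θ : ℂ) + t * I + α + 1 - (m : ℂ)))) ∧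
    ∫ ω in Set.Ici ωc, ((ω - μ : ℝ) : ℂ) ^ (α - (m : ℂ)) * fdC (β * (ω - μ))
      = (β : ℂ) ^ ((m : ℂ) - α - 1) *
          (Complex.Gamma (α + 1 - (m : ℂ)) * etaC (α + 1 - (m : ℂ)))
        - ∑ l ∈ Finset.range L, b l * (β : ℂ) ^ l *
          (((ωc - μ : ℝ) : ℂ) ^ ((l : ℂ) + α + 1 - (m : ℂ)) / ((l : ℂ) + α + 1 - (m : ℂ)))
        - (1 / (2 * (Real.pi : ℂ))) * ∫ t : ℝ,
          (Complex.Gamma (-(θ : ℂ) - t * I) * etaC (-(θ : ℂ) - t * I)) *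
          (β : ℂ) ^ ((θ : ℂ) + t * I) * (((ωc - μ : ℝ) : ℂ) ^ ((θ : ℂ) + t * I + α + 1 - (m : ℂ))
          / ((θ : ℂ) + t * I + α + 1 - (m : ℂ))) := by
  have hP := power_lemma hb L hθ hL1 hL2 hβ (sub_pos.2 hμ) (γ := α + 1 - (m : ℂ))
    (by simp; linarith) (fun n h => hα (n - 1 + m) (by push_cast; linear_combination h))
  have hS := power_shift (f := fun x : ℝ => (x : ℂ) ^ (α - (m : ℂ)) * fdC (β * x))
    (ωc := ωc) (μ := μ)
  have e1 : α + 1 - (m : ℂ) - 1 = α - m := by ring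
  have e2 : -(α + 1 - (m : ℂ)) = m - α - 1 := by ring
  have e3 : ∀ s : ℂ, s + (α + 1 - (m : ℂ)) = s + α + 1 - m := fun s => by ring
  simp only [e1, e2, e3] at hP
  exact ⟨hS.1.2 hP.1, hP.2.1, hS.2.trans hP.2.2⟩


/-- Exact fermionic high-temperature expansion, with the Dirichlet eta
function `η(z) = (1 − 2^{1−z}) ζ(z)` replacing the Riemann zeta function:
`∫_{ω_c}^∞ g(ω)/(e^{β(ω−μ)}+1) dω
  = ∑_{m=0}^N β^{m−α−1} η(α+1−m) ∑_{n=0}^m Γ(α+1−m+n) c_{m−n} μⁿ/n!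
    + ∑_{l=0}^{⌊θ⌋} ((−1)^l η(−l)/l!) β^l Σ_g(l,μ)
    + (1/2π) ∫_ℝ Γ(−θ−it) η(−θ−it) β^{θ+it} Σ_g(θ+it,μ) dt`,
all integrals converging absolutely; there is no `l = −1` term since `η` is regular at `1`. -/
theorem stmt15 (α : ℂ) (hα : ∀ n : ℤ, α ≠ (n : ℂ)) (N : ℕ) (ωc μ β : ℝ)
    (hωc : 0 < ωc) (hμ0 : 0 < μ) (hμ : μ < ωc) (hβ : 0 < β)
    (c : ℕ → ℂ) (g : ℝ → ℂ)
    (hmeas : Measurable g)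
    (hloc : LocallyIntegrableOn g (Set.Ici ωc))
    (hasymp : (fun ω : ℝ => g ω - ∑ k ∈ Finset.range (N + 1), c k * (ω : ℂ) ^ (α - (k : ℂ)))
      =O[Filter.atTop] fun ω : ℝ => ω ^ (α.re - (N : ℝ) - 1))
    (a : ℕ → ℂ)
    (ha : ∀ m : ℕ, a m = ∑ n ∈ Finset.range (m + 1),
      c (m - n) * (Complex.Gamma (α + 1 - (m : ℂ) + (n : ℂ)) / Complex.Gamma (α + 1 - (m : ℂ)))
        * (μ : ℂ) ^ n / (n.factorial : ℂ))
    (G : ℂ → ℂ)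
    (hG : ∀ s : ℂ, G s =
      (∫ ω in Set.Ici ωc, ((ω - μ : ℝ) : ℂ) ^ s *
          (g ω - ∑ m ∈ Finset.range (N + 1), a m * ((ω - μ : ℝ) : ℂ) ^ (α - (m : ℂ))))
        - ∑ m ∈ Finset.range (N + 1),
            a m * ((ωc - μ : ℝ) : ℂ) ^ (s + α + 1 - (m : ℂ)) / (s + α + 1 - (m : ℂ)))
    (η : ℂ → ℂ) (hη : ∀ z : ℂ, η z = (1 - (2 : ℂ) ^ (1 - z)) * riemannZeta z)
    (θ : ℝ) (hθZ : ∀ n : ℤ, θ ≠ (n : ℝ)) (hθ1 : -1 < θ)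
    (hθ2 : (N : ℝ) - α.re - 1 < θ) (hθ3 : θ < (N : ℝ) - α.re) :
    IntegrableOn (fun ω : ℝ => g ω / ((Real.exp (β * (ω - μ)) : ℂ) + 1)) (Set.Ici ωc) ∧
    Integrable (fun t : ℝ =>
      Complex.Gamma (-(θ : ℂ) - (t : ℂ) * Complex.I) *
        η (-(θ : ℂ) - (t : ℂ) * Complex.I) *
        (β : ℂ) ^ ((θ : ℂ) + (t : ℂ) * Complex.I) * G ((θ : ℂ) + (t : ℂ) * Complex.I)) ∧
    (∫ ω in Set.Ici ωc, g ω / ((Real.exp (β * (ω - μ)) : ℂ) + 1))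
      = (∑ m ∈ Finset.range (N + 1), (β : ℂ) ^ ((m : ℂ) - α - 1) *
            η (α + 1 - (m : ℂ)) *
            ∑ n ∈ Finset.range (m + 1),
              Complex.Gamma (α + 1 - (m : ℂ) + (n : ℂ)) * c (m - n) * (μ : ℂ) ^ n /
                (n.factorial : ℂ))
        + (∑ l ∈ Finset.range ((⌊θ⌋ + 1).toNat),
            ((-1 : ℂ) ^ l * η (-(l : ℂ)) / (l.factorial : ℂ)) * (β : ℂ) ^ l * G (l : ℂ))
        + (1 / (2 * (Real.pi : ℂ))) *
            ∫ t : ℝ, Complex.Gamma (-(θ : ℂ) - (t : ℂ) * Complex.I) *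
              η (-(θ : ℂ) - (t : ℂ) * Complex.I) *
              (β : ℂ) ^ ((θ : ℂ) + (t : ℂ) * Complex.I) *
              G ((θ : ℂ) + (t : ℂ) * Complex.I) := by
  obtain ⟨b, hb⟩ := fd_taylor
  obtain rfl : η = etaC := funext fun z => hη z
  set L := (⌊θ⌋ + 1).toNat with hL
  have hfl : (-1 : ℤ) ≤ ⌊θ⌋ := Int.le_floor.2 (by push_cast; exact hθ1.le)
  have hLZ : (L : ℤ) = ⌊θ⌋ + 1 := by rw [hL]; exact Int.toNat_of_nonneg (by omega)
  have hLR : (L : ℝ) = (⌊θ⌋ : ℝ) + 1 := by exact_mod_cast hLZ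
  have hL1 : θ < L := by rw [hLR]; exact Int.lt_floor_add_one θ
  have hL2 : ∀ l : ℕ, l < L → (l : ℝ) < θ := by
    intro l hl
    have h1 : (l : ℤ) ≤ ⌊θ⌋ := by omega
    have h2 : ((l : ℤ) : ℝ) ≤ θ := Int.le_floor.1 h1
    exact lt_of_le_of_ne (by exact_mod_cast h2) (fun h => hθZ l (by rw [← h]; simp))
  set r : ℝ → ℂ := fun ω => g ω -
    ∑ m ∈ Finset.range (N + 1), a m * ((ω - μ : ℝ) : ℂ) ^ (α - (m : ℂ)) with hr
  have hpos : ∀ ω ∈ Set.Ici ωc, 0 < ω - μ := fun ω hω => sub_pos.2 (hμ.trans_le hω)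
  have hrm : Measurable r := by
    refine hmeas.sub (Finset.measurable_fun_sum _ fun m _ => Measurable.const_mul ?_ _)
    exact (Complex.measurable_ofReal.comp (by fun_prop)).pow_const _
  have hrl : LocallyIntegrableOn r (Set.Ici ωc) := by
    refine hloc.sub (ContinuousOn.locallyIntegrableOn ?_ measurableSet_Ici)
    refine continuousOn_finsetSum _ fun m _ => ContinuousOn.mul continuousOn_const ?_
    intro ω hω
    refine ContinuousAt.continuousWithinAt ?_
    refine ContinuousAt.cpow (by fun_prop) (by fun_prop) ?_
    exact Or.inl (by simpa using hpos ω hω)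
  have hrO := r_asymp α hα N μ hμ0 c g hasymp a ha
  obtain ⟨R1, R2, R3⟩ := rem_lemma hb L hθZ hL1 hL2 hβ hμ hrm hrl hrO (by linarith)
  have hP := fun m (hm : m ∈ Finset.range (N + 1)) =>
    power_lemma2 hb L hθZ hL1 hL2 hβ hμ hα m (by
      have : m ≤ N := by simpa [Nat.lt_succ_iff] using hm
      have : (m : ℝ) ≤ N := by exact_mod_cast this
      linarith)
  have hGt : ∀ s : ℂ, G s = (∫ ω in Set.Ici ωc, ((ω - μ : ℝ) : ℂ) ^ s * r ω)
      - ∑ m ∈ Finset.range (N + 1), a m *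
        (((ωc - μ : ℝ) : ℂ) ^ (s + α + 1 - (m : ℂ)) / (s + α + 1 - (m : ℂ))) := by
    intro s
    rw [hG]
    simp only [mul_div_assoc, hr]
  have eq : ∀ ω : ℝ, g ω / ((Real.exp (β * (ω - μ)) : ℂ) + 1) = r ω * fdC (β * (ω - μ)) +
      ∑ m ∈ Finset.range (N + 1), a m *
        (((ω - μ : ℝ) : ℂ) ^ (α - (m : ℂ)) * fdC (β * (ω - μ))) := by
    intro ω
    have h1 : g ω / ((Real.exp (β * (ω - μ)) : ℂ) + 1) = g ω * fdC (β * (ω - μ)) := by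
      rw [fdC, fdR]
      push_cast
      ring
    rw [h1, hr]
    simp only [sub_mul, Finset.sum_mul, mul_assoc]
    ring
  have eqt : ∀ t : ℝ, Complex.Gamma (-(θ : ℂ) - (t : ℂ) * Complex.I) *
        etaC (-(θ : ℂ) - (t : ℂ) * Complex.I) *
        (β : ℂ) ^ ((θ : ℂ) + (t : ℂ) * Complex.I) * G ((θ : ℂ) + (t : ℂ) * Complex.I) =
      (Complex.Gamma (-(θ : ℂ) - t * I) * etaC (-(θ : ℂ) - t * I)) *
        (β : ℂ) ^ ((θ : ℂ) + t * I) *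
          (∫ ω in Set.Ici ωc, ((ω - μ : ℝ) : ℂ) ^ ((θ : ℂ) + t * I) * r ω) -
      ∑ m ∈ Finset.range (N + 1), a m *
        ((Complex.Gamma (-(θ : ℂ) - t * I) * etaC (-(θ : ℂ) - t * I)) *
        (β : ℂ) ^ ((θ : ℂ) + t * I) * (((ωc - μ : ℝ) : ℂ) ^ ((θ : ℂ) + t * I + α + 1 - (m : ℂ))
          / ((θ : ℂ) + t * I + α + 1 - (m : ℂ)))) := by
    intro t
    rw [hGt, mul_sub, Finset.mul_sum]
    congr 1
    refine Finset.sum_congr rfl fun m _ => ?_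
    ring
  have i1 := fun m hm => (hP m hm).1.const_mul (a m)
  have i2 := fun m hm => (hP m hm).2.1.const_mul (a m)
  refine ⟨?_, ?_, ?_⟩
  · simp only [eq]
    exact R1.add (integrable_finsetSum _ i1)
  · simp only [eqt]
    exact R2.sub (integrable_finsetSum _ i2)
  · simp only [eq, eqt]
    rw [integral_add R1 (integrable_finsetSum _ i1), integral_finsetSum _ i1,
      integral_sub R2 (integrable_finsetSum _ i2), integral_finsetSum _ i2, R3]
    have E1 : ∀ m ∈ Finset.range (N + 1), a m * (∫ ω in Set.Ici ωc, ((ω - μ : ℝ) : ℂ) ^ (α - (m : ℂ)) * fdC (β * (ω - μ)))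
        = (β : ℂ) ^ ((m : ℂ) - α - 1) * etaC (α + 1 - (m : ℂ)) *
            (∑ n ∈ Finset.range (m + 1),
              Complex.Gamma (α + 1 - (m : ℂ) + (n : ℂ)) * c (m - n) * (μ : ℂ) ^ n /
                (n.factorial : ℂ))
        - (∑ l ∈ Finset.range L, b l * (β : ℂ) ^ l * (a m *
          (((ωc - μ : ℝ) : ℂ) ^ ((l : ℂ) + α + 1 - (m : ℂ)) / ((l : ℂ) + α + 1 - (m : ℂ)))))
        - (1 / (2 * (Real.pi : ℂ))) * (a m * ∫ t : ℝ,
          (Complex.Gamma (-(θ : ℂ) - t * I) * etaC (-(θ : ℂ) - t * I)) *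
          (β : ℂ) ^ ((θ : ℂ) + t * I) * (((ωc - μ : ℝ) : ℂ) ^ ((θ : ℂ) + t * I + α + 1 - (m : ℂ))
          / ((θ : ℂ) + t * I + α + 1 - (m : ℂ)))) := by
      intro m hm
      have hΓ : Complex.Gamma (α + 1 - (m : ℂ)) ≠ 0 := Complex.Gamma_ne_zero fun k hk =>
        hα (m - 1 - k) (by push_cast; linear_combination hk)
      have hs : (∑ n ∈ Finset.range (m + 1),
              Complex.Gamma (α + 1 - (m : ℂ) + (n : ℂ)) * c (m - n) * (μ : ℂ) ^ n /
                (n.factorial : ℂ)) = a m * Complex.Gamma (α + 1 - (m : ℂ)) := by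
        rw [ha, Finset.sum_mul]
        refine Finset.sum_congr rfl fun n _ => ?_
        field_simp
      rw [hs, (hP m hm).2.2, mul_sub, mul_sub, Finset.mul_sum]
      congr 1
      · congr 1
        · ring
        · exact Finset.sum_congr rfl fun l _ => by ring
      · ring
    simp only [integral_const_mul]
    rw [Finset.sum_congr rfl E1]
    simp only [integral_const_mul, Finset.sum_sub_distrib, ← fd_coeff hb, hGt, mul_sub,
      Finset.mul_sum]
    rw [Finset.sum_comm (s := Finset.range (N + 1)) (t := Finset.range L)]
    ring
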